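/- Let a, b ∈ ℂ[u,v] ⊆ ℂ[x,y,u,v] be homogeneous polynomials of degree 2 having no common zero in ℂ² ∖ {0}, and let I = (a·x + b·y, x², x·y, y²) ⊆ R = ℂ[x,y,u,v]. Then there exists a natural number N such that for all t ≥ N the Hilbert function of R/I at t equals 2t + 3. (This is the Hilbert polynomial of the unique double structure δ on the line x = y = 0 contained in a smooth cubic surface.) -/

import Mathlib

open MvPolynomial

/-- The Hilbert function of `R ⧸ I` at `t`, for a homogeneous ideal `I` of
`R = ℂ[x,y,u,v]`: `dim_ℂ R_t − dim_ℂ (I ∩ R_t)`. -/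
noncomputable def hilbertFn (I : Ideal (MvPolynomial (Fin 4) ℂ)) (t : ℕ) : ℤ :=
  (Module.finrank ℂ (MvPolynomial.homogeneousSubmodule (Fin 4) ℂ t) : ℤ) -
    (Module.finrank ℂ
      ↥(Submodule.restrictScalars ℂ I ⊓ MvPolynomial.homogeneousSubmodule (Fin 4) ℂ t) : ℤ)

/-- Variables: `x = X 0`, `y = X 1`, `u = X 2`, `v = X 3`; `ℂ[u,v] ⊆ ℂ[x,y,u,v]`. -/
noncomputable def embUV : MvPolynomial (Fin 2) ℂ →ₐ[ℂ] MvPolynomial (Fin 4) ℂ :=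
  MvPolynomial.rename (fun i : Fin 2 => (i.succ.succ : Fin 4))

namespace MvPolynomial

theorem finrank_homogeneousSubmodule {σ K : Type*} [Fintype σ] [DecidableEq σ] [Field K] (n : ℕ) :
    Module.finrank K (homogeneousSubmodule σ K n) =
      (Finset.univ.finsuppAntidiag n : Finset (σ →₀ ℕ)).card := by
  have hset : {d : σ →₀ ℕ | d.degree = n} = ↑(Finset.univ.finsuppAntidiag n : Finset (σ →₀ ℕ)) := by
    ext d
    simp [Finsupp.degree_eq_sum]
  rw [homogeneousSubmodule_eq_finsupp_supported, hset,
    (AddMonoidAlgebra.supportedEquivFinsupp _).finrank_eq]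
  simp

theorem finrank_homogeneousSubmodule_fin_two {K : Type*} [Field K] (n : ℕ) :
    Module.finrank K (homogeneousSubmodule (Fin 2) K n) = n + 1 := by
  rw [finrank_homogeneousSubmodule, Finset.card_finsuppAntidiag_nat_eq_choose]
  simp [Nat.add_comm]

instance finite_homogeneousSubmodule {σ K : Type*} [Finite σ] [Field K] (n : ℕ) :
    Module.Finite K (homogeneousSubmodule σ K n) :=
  Module.Finite.iff_fg.mpr (homogeneousSubmodule_fg σ K n)

theorem IsHomogeneous.homogeneousComponent_mul {σ K : Type*} [CommSemiring K]
    {p : MvPolynomial σ K} {m : ℕ} (hp : p.IsHomogeneous m) (q : MvPolynomial σ K) (n : ℕ) :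
    homogeneousComponent (m + n) (p * q) = p * homogeneousComponent n q := by
  let : GradedAlgebra (homogeneousSubmodule σ K) := MvPolynomial.gradedAlgebra
  rw [← decomposition.decompose'_apply, ← decomposition.decompose'_apply]
  exact DirectSum.coe_decompose_mul_add_of_left_mem (homogeneousSubmodule σ K) hp

theorem pderiv_rename_of_notMem_range {σ τ K : Type*} [CommSemiring K] {f : σ → τ} {i : τ}
    (hi : i ∉ Set.range f) (p : MvPolynomial σ K) : pderiv i (rename f p) = 0 := by
  classical
  refine pderiv_eq_zero_of_notMem_vars fun h => hi ?_
  obtain ⟨j, -, rfl⟩ := Finset.mem_image.mp (vars_rename f p h)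
  exact ⟨j, rfl⟩

end MvPolynomial

theorem Submodule.finrank_map_add_finrank_inf_ker {K V W : Type*} [Field K] [AddCommGroup V]
    [Module K V] [AddCommGroup W] [Module K W] (f : V →ₗ[K] W) (p : Submodule K V)
    [FiniteDimensional K p] :
    Module.finrank K (p.map f) + Module.finrank K ↥(p ⊓ LinearMap.ker f) =
      Module.finrank K p := by
  rw [← LinearMap.finrank_range_add_finrank_ker (f.domRestrict p), LinearMap.range_domRestrict,
    LinearMap.ker_domRestrict, ← Submodule.finrank_map_subtype_eq, Submodule.map_comap_subtype]

theorem Submodule.finrank_prod {K V W : Type*} [Field K] [AddCommGroup V]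
    [Module K V] [AddCommGroup W] [Module K W] (p : Submodule K V) (q : Submodule K W)
    [FiniteDimensional K p] [FiniteDimensional K q] :
    Module.finrank K (p.prod q) = Module.finrank K p + Module.finrank K q := by
  rw [← Module.finrank_prod]
  exact LinearEquiv.finrank_eq
    { toFun := fun x => (⟨x.1.1, x.2.1⟩, ⟨x.1.2, x.2.2⟩)
      invFun := fun x => ⟨(x.1, x.2), x.1.2, x.2.2⟩
      map_add' := fun _ _ => rfl
      map_smul' := fun _ _ => rfl }

/-- Restriction of polynomials to the line `x = y = 0`. -/
noncomputable def restrictLine : MvPolynomial (Fin 4) ℂ →ₐ[ℂ] MvPolynomial (Fin 2) ℂ :=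
  aeval ![0, 0, X 0, X 1]

/-- The first-order jet along the line `x = y = 0`: the coefficients of `1`, `x` and `y`
of a polynomial seen as an element of `ℂ[u,v][x,y]`. -/
noncomputable def lineJet : MvPolynomial (Fin 4) ℂ →ₗ[ℂ]
    MvPolynomial (Fin 2) ℂ × MvPolynomial (Fin 2) ℂ × MvPolynomial (Fin 2) ℂ :=
  restrictLine.toLinearMap.prod
    ((restrictLine.toLinearMap ∘ₗ (pderiv 0).toLinearMap).prod
      (restrictLine.toLinearMap ∘ₗ (pderiv 1).toLinearMap))

theorem lineJet_apply (p : MvPolynomial (Fin 4) ℂ) :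
    lineJet p = (restrictLine p, restrictLine (pderiv 0 p), restrictLine (pderiv 1 p)) :=
  rfl

@[simp]
theorem restrictLine_embUV (s : MvPolynomial (Fin 2) ℂ) : restrictLine (embUV s) = s := by
  have h : restrictLine.comp embUV = AlgHom.id ℂ (MvPolynomial (Fin 2) ℂ) := by
    ext i : 1
    fin_cases i <;> simp [restrictLine, embUV]
  exact DFunLike.congr_fun h s

@[simp]
theorem restrictLine_X_zero : restrictLine (X 0) = 0 := by simp [restrictLine]

@[simp]
theorem restrictLine_X_one : restrictLine (X 1) = 0 := by simp [restrictLine]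

@[simp]
theorem pderiv_zero_embUV (s : MvPolynomial (Fin 2) ℂ) : pderiv 0 (embUV s) = 0 :=
  pderiv_rename_of_notMem_range (by decide) s

@[simp]
theorem pderiv_one_embUV (s : MvPolynomial (Fin 2) ℂ) : pderiv 1 (embUV s) = 0 :=
  pderiv_rename_of_notMem_range (by decide) s

theorem isHomogeneous_embUV {s : MvPolynomial (Fin 2) ℂ} {n : ℕ} (hs : s.IsHomogeneous n) :
    (embUV s).IsHomogeneous n :=
  hs.rename_isHomogeneous

theorem isHomogeneous_restrictLine {p : MvPolynomial (Fin 4) ℂ} {n : ℕ} (hp : p.IsHomogeneous n) :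
    (restrictLine p).IsHomogeneous n := by
  have h := hp.aeval (n := 1) (![0, 0, X 0, X 1] : Fin 4 → MvPolynomial (Fin 2) ℂ) (fun i => by
    fin_cases i <;> simp [isHomogeneous_X, isHomogeneous_zero])
  simpa [restrictLine] using h

@[simp]
theorem lineJet_linear (p q r : MvPolynomial (Fin 2) ℂ) :
    lineJet (embUV p + embUV q * X 0 + embUV r * X 1) = (p, q, r) := by
  simp [lineJet_apply, pderiv_X]

theorem sub_linear_mem (p : MvPolynomial (Fin 4) ℂ) :
    p - (embUV (restrictLine p) + embUV (restrictLine (pderiv 0 p)) * X 0 +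
      embUV (restrictLine (pderiv 1 p)) * X 1) ∈
      Ideal.span {X 0 ^ 2, X 0 * X 1, (X 1 ^ 2 : MvPolynomial (Fin 4) ℂ)} := by
  set J : Ideal (MvPolynomial (Fin 4) ℂ) := Ideal.span {X 0 ^ 2, X 0 * X 1, X 1 ^ 2} with hJ
  have hxx : X 0 ^ 2 ∈ J := Ideal.subset_span (by simp)
  have hxy : X 0 * X 1 ∈ J := Ideal.subset_span (by simp)
  have hyy : X 1 ^ 2 ∈ J := Ideal.subset_span (by simp)
  induction p using MvPolynomial.induction_on with
  | C r => simp [restrictLine, embUV]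
  | add p q hp hq =>
    convert J.add_mem hp hq using 1
    simp only [map_add]
    ring
  | mul_X p i hp =>
    have key := J.mul_mem_right (X i) hp
    fin_cases i
    · convert J.add_mem key (J.add_mem
        (J.mul_mem_left (embUV (restrictLine (pderiv 0 p))) hxx)
        (J.mul_mem_left (embUV (restrictLine (pderiv 1 p))) hxy)) using 1
      simp [pderiv_X]
      ring
    · convert J.add_mem key (J.add_mem
        (J.mul_mem_left (embUV (restrictLine (pderiv 0 p))) hxy)
        (J.mul_mem_left (embUV (restrictLine (pderiv 1 p))) hyy)) using 1
      simp [pderiv_X]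
      ring
    · convert key using 1
      simp [pderiv_X, restrictLine, embUV]
      ring
    · convert key using 1
      simp [pderiv_X, restrictLine, embUV]
      ring

theorem mem_span_of_lineJet_eq_zero {p : MvPolynomial (Fin 4) ℂ} (hp : lineJet p = 0) :
    p ∈ Ideal.span {X 0 ^ 2, X 0 * X 1, (X 1 ^ 2 : MvPolynomial (Fin 4) ℂ)} := by
  simp only [lineJet_apply, Prod.mk_eq_zero] at hp
  simpa [hp] using sub_linear_mem p

theorem map_lineJet_homogeneousSubmodule (n : ℕ) :
    (homogeneousSubmodule (Fin 4) ℂ (n + 1)).map lineJet =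
      (homogeneousSubmodule (Fin 2) ℂ (n + 1)).prod
        ((homogeneousSubmodule (Fin 2) ℂ n).prod (homogeneousSubmodule (Fin 2) ℂ n)) := by
  apply le_antisymm
  · rintro _ ⟨p, hp, rfl⟩
    exact ⟨isHomogeneous_restrictLine hp, isHomogeneous_restrictLine hp.pderiv,
      isHomogeneous_restrictLine hp.pderiv⟩
  · rintro ⟨p, q, r⟩ ⟨hp, hq, hr⟩
    exact ⟨_, ((isHomogeneous_embUV hp).add ((isHomogeneous_embUV hq).mul (isHomogeneous_X _ _))).add
      ((isHomogeneous_embUV hr).mul (isHomogeneous_X _ _)), lineJet_linear p q r⟩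

/-- The ideal of the double structure on the line `x = y = 0` defined by `a x + b y`. -/
noncomputable abbrev doubleLineIdeal (a b : MvPolynomial (Fin 2) ℂ) :
    Ideal (MvPolynomial (Fin 4) ℂ) :=
  Ideal.span {embUV a * X 0 + embUV b * X 1, X 0 ^ 2, X 0 * X 1, X 1 ^ 2}

theorem exists_lineJet_eq_of_mem {a b : MvPolynomial (Fin 2) ℂ} {p : MvPolynomial (Fin 4) ℂ}
    (hp : p ∈ doubleLineIdeal a b) : ∃ s, lineJet p = (0, a * s, b * s) := by
  simp only [doubleLineIdeal, Ideal.mem_span_insert, Ideal.mem_span_singleton'] at hp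
  obtain ⟨r, _, ⟨r₁, _, ⟨r₂, _, ⟨r₃, rfl⟩, rfl⟩, rfl⟩, rfl⟩ := hp
  exact ⟨restrictLine r, by simp [lineJet_apply, pderiv_X, mul_comm]⟩

/-- Multiplication of the pair `(a, b)` by a polynomial, placed in degree one of the jets. -/
noncomputable def mulPair (a b : MvPolynomial (Fin 2) ℂ) : MvPolynomial (Fin 2) ℂ →ₗ[ℂ]
    MvPolynomial (Fin 2) ℂ × MvPolynomial (Fin 2) ℂ × MvPolynomial (Fin 2) ℂ :=
  LinearMap.prod 0 ((LinearMap.mulLeft ℂ a).prod (LinearMap.mulLeft ℂ b))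

theorem mulPair_apply (a b s : MvPolynomial (Fin 2) ℂ) : mulPair a b s = (0, a * s, b * s) :=
  rfl

theorem mulPair_injective {a b : MvPolynomial (Fin 2) ℂ} (h : a ≠ 0 ∨ b ≠ 0) :
    Function.Injective (mulPair a b) := by
  intro s t hst
  simp only [mulPair_apply, Prod.mk.injEq, true_and] at hst
  rcases h with h | h
  · exact mul_left_cancel₀ h hst.1
  · exact mul_left_cancel₀ h hst.2

theorem map_lineJet_doubleLineIdeal {a b : MvPolynomial (Fin 2) ℂ} {d : ℕ}
    (ha : a.IsHomogeneous d) (hb : b.IsHomogeneous d) (n : ℕ) :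
    (Submodule.restrictScalars ℂ (doubleLineIdeal a b) ⊓
        homogeneousSubmodule (Fin 4) ℂ (d + n + 1)).map lineJet =
      (homogeneousSubmodule (Fin 2) ℂ n).map (mulPair a b) := by
  apply le_antisymm
  · rintro _ ⟨p, ⟨hpI, hp⟩, rfl⟩
    obtain ⟨s, hs⟩ := exists_lineJet_eq_of_mem hpI
    obtain ⟨-, h₁, h₂⟩ := (map_lineJet_homogeneousSubmodule (d + n)).le ⟨p, hp, rfl⟩
    rw [hs] at h₁ h₂ ⊢
    refine ⟨homogeneousComponent n s, homogeneousComponent_isHomogeneous n s, ?_⟩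
    rw [mulPair_apply, ← ha.homogeneousComponent_mul, ← hb.homogeneousComponent_mul,
      homogeneousComponent_eq_self h₁, homogeneousComponent_eq_self h₂]
  · rintro _ ⟨s, hs, rfl⟩
    refine ⟨embUV (a * s) * X 0 + embUV (b * s) * X 1, ⟨?_, ?_⟩, ?_⟩
    · have h : embUV a * X 0 + embUV b * X 1 ∈ doubleLineIdeal a b := Ideal.subset_span (by simp)
      refine (congrArg (· ∈ doubleLineIdeal a b) ?_).mp
        ((doubleLineIdeal a b).mul_mem_left (embUV s) h)
      simp only [map_mul]
      ring
    · exact ((isHomogeneous_embUV (ha.mul hs)).mul (isHomogeneous_X _ _)).add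
        ((isHomogeneous_embUV (hb.mul hs)).mul (isHomogeneous_X _ _))
    · simpa [mulPair_apply] using lineJet_linear 0 (a * s) (b * s)

theorem hilbertFn_doubleLineIdeal {a b : MvPolynomial (Fin 2) ℂ} {d : ℕ}
    (ha : a.IsHomogeneous d) (hb : b.IsHomogeneous d) (h : a ≠ 0 ∨ b ≠ 0) (n : ℕ) :
    hilbertFn (doubleLineIdeal a b) (d + n + 1) = 3 * d + 2 * n + 3 := by
  have hker : Submodule.restrictScalars ℂ (doubleLineIdeal a b) ⊓
      homogeneousSubmodule (Fin 4) ℂ (d + n + 1) ⊓ LinearMap.ker lineJet =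
      homogeneousSubmodule (Fin 4) ℂ (d + n + 1) ⊓ LinearMap.ker lineJet := by
    rw [inf_assoc, inf_eq_right]
    rintro p ⟨-, hp⟩
    exact Ideal.span_mono (Set.subset_insert _ _) (mem_span_of_lineJet_eq_zero hp)
  have : FiniteDimensional ℂ ↥(Submodule.restrictScalars ℂ (doubleLineIdeal a b) ⊓
      homogeneousSubmodule (Fin 4) ℂ (d + n + 1)) :=
    Submodule.finiteDimensional_of_le inf_le_right
  have hR := Submodule.finrank_map_add_finrank_inf_ker lineJet
    (homogeneousSubmodule (Fin 4) ℂ (d + n + 1))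
  have hI := Submodule.finrank_map_add_finrank_inf_ker lineJet
    (Submodule.restrictScalars ℂ (doubleLineIdeal a b) ⊓
      homogeneousSubmodule (Fin 4) ℂ (d + n + 1))
  rw [hker, map_lineJet_doubleLineIdeal ha hb,
    ← (Submodule.equivMapOfInjective _ (mulPair_injective h) _).finrank_eq,
    finrank_homogeneousSubmodule_fin_two] at hI
  have : FiniteDimensional ℂ ↥((homogeneousSubmodule (Fin 2) ℂ (d + n)).prod
      (homogeneousSubmodule (Fin 2) ℂ (d + n))) :=
    Module.Finite.iff_fg.mpr ((homogeneousSubmodule_fg _ _ _).prod (homogeneousSubmodule_fg _ _ _))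
  rw [map_lineJet_homogeneousSubmodule, Submodule.finrank_prod, Submodule.finrank_prod] at hR
  simp only [finrank_homogeneousSubmodule_fin_two] at hR
  unfold hilbertFn
  omega

theorem double_line_hilbert_polynomial
    (a b : MvPolynomial (Fin 2) ℂ)
    (ha : a.IsHomogeneous 2) (hb : b.IsHomogeneous 2)
    (hab : ∀ p : Fin 2 → ℂ, p ≠ 0 → ¬(eval p a = 0 ∧ eval p b = 0)) :
    ∃ N : ℕ, ∀ t : ℕ, N ≤ t →
      hilbertFn (Ideal.span
        {embUV a * X 0 + embUV b * X 1, X 0 ^ 2, X 0 * X 1, X 1 ^ 2}) t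
        = 2 * (t : ℤ) + 3 := by
  have h : a ≠ 0 ∨ b ≠ 0 := by
    by_contra! h
    exact hab 1 one_ne_zero (by simp [h.1, h.2])
  refine ⟨3, fun t ht => ?_⟩
  obtain ⟨n, rfl⟩ := Nat.exists_eq_add_of_le ht
  have key := hilbertFn_doubleLineIdeal ha hb h n
  rw [show 2 + n + 1 = 3 + n by ring] at key
  rw [key]
  push_cast
  ring
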